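/- Let K : ℝ → ℝ be measurable with 0 ≤ K(x) ≤ 1 and K(x) + K(−x) = 1 for all x ∈ ℝ, and suppose t ↦ t·K(−t) is integrable on [0, ∞) with C = ∫_0^∞ t·K(−t) dt. Let M ≥ 0 and let f : ℝ → ℝ be integrable and differentiable with |f′(x)| ≤ M for all x ∈ ℝ. Then for every τ > 0, |∫_ℝ (K(−ε/τ) − 𝟙(ε ≤ 0))·f(ε) dε| ≤ 2·M·C·τ². (The smoothing bias of replacing the indicator 𝟙(ε ≤ 0) by the local distribution function K(−ε/τ) is of order τ².) -/

import Mathlib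

open MeasureTheory

/-- Smoothing bias bound: if `K` is a measurable local distribution function
with values in `[0,1]`, satisfying `K(x) + K(-x) = 1`, with
`C = ∫_0^∞ t·K(-t) dt` finite, `f` is integrable and differentiable with
`|f'| ≤ M`, then for every bandwidth `τ > 0`,
`|∫ (K(-ε/τ) - 𝟙(ε ≤ 0))·f(ε) dε| ≤ 2·M·C·τ²`. -/
theorem stmt8 (K : ℝ → ℝ) (hKmeas : Measurable K)
    (hK0 : ∀ x : ℝ, 0 ≤ K x) (hK1 : ∀ x : ℝ, K x ≤ 1)
    (hKsym : ∀ x : ℝ, K x + K (-x) = 1)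
    (hKint : IntegrableOn (fun t : ℝ => t * K (-t)) (Set.Ici 0))
    (C : ℝ) (hC : C = ∫ t in Set.Ici (0 : ℝ), t * K (-t))
    (M : ℝ) (hM : 0 ≤ M) (f : ℝ → ℝ)
    (hfint : Integrable f) (hfdiff : Differentiable ℝ f)
    (hfderiv : ∀ x : ℝ, |deriv f x| ≤ M) :
    ∀ τ : ℝ, 0 < τ →
      |∫ ε : ℝ, (K (-(ε / τ)) - (if ε ≤ 0 then (1 : ℝ) else 0)) * f ε|
        ≤ 2 * M * C * τ ^ 2 := by
  intro τ hτ
  set g : ℝ → ℝ := fun ε => (K (-(ε / τ)) - (if ε ≤ 0 then (1 : ℝ) else 0)) * f ε with hg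
  have hgi : Integrable g := by
    refine hfint.bdd_mul (c := 1) ?_ ?_
    · apply Measurable.aestronglyMeasurable
      refine Measurable.sub (hKmeas.comp (by fun_prop)) ?_
      exact Measurable.ite measurableSet_Iic measurable_const measurable_const
    · refine Filter.Eventually.of_forall fun x => ?_
      have h0 := hK0 (-(x / τ))
      have h1 := hK1 (-(x / τ))
      rw [Real.norm_eq_abs, abs_le]
      split_ifs <;> constructor <;> linarith
  have hgn : Integrable (fun x => g (-x)) := hgi.comp_neg
  have e1 : ∫ x, g x = ∫ x in Set.Ioi (0 : ℝ), (g (-x) + g x) := by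
    rw [integral_add hgn.integrableOn hgi.integrableOn, ← intervalIntegral.integral_Iic_add_Ioi
      (b := (0 : ℝ)) hgi.integrableOn hgi.integrableOn]
    congr 1
    have := integral_comp_neg_Iic (0 : ℝ) (fun x => g (-x))
    simpa using this
  have hlip : ∀ x : ℝ, 0 < x → |f x - f (-x)| ≤ 2 * M * x := by
    intro x hx
    have := Convex.norm_image_sub_le_of_norm_deriv_le (f := f) (C := M) (s := Set.univ)
      (x := -x) (y := x) (fun y _ => hfdiff y) (fun y _ => hfderiv y) convex_univ trivial trivial
    rw [Real.norm_eq_abs, Real.norm_eq_abs, abs_of_pos (by linarith : 0 < x - -x)] at this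
    linarith
  have hτi : 0 < τ⁻¹ := inv_pos.mpr hτ
  have hI : IntegrableOn (fun t : ℝ => t * K (-t)) (Set.Ioi 0) :=
    hKint.mono_set Set.Ioi_subset_Ici_self
  have hI2 : IntegrableOn (fun t : ℝ => (τ⁻¹ * t) * K (-(τ⁻¹ * t))) (Set.Ioi 0) := by
    have := (integrableOn_Ioi_comp_mul_left_iff (fun t : ℝ => t * K (-t)) 0 hτi).2
      (by simpa using hI)
    exact this
  have e2 : ∫ t in Set.Ioi (0 : ℝ), (τ⁻¹ * t) * K (-(τ⁻¹ * t)) = τ * C := by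
    have := integral_comp_mul_left_Ioi (fun t : ℝ => t * K (-t)) 0 hτi
    rw [hC, integral_Ici_eq_integral_Ioi]
    simpa using this
  have e3 : 2 * M * C * τ ^ 2
      = ∫ t in Set.Ioi (0 : ℝ), (2 * M * τ) * ((τ⁻¹ * t) * K (-(τ⁻¹ * t))) := by
    rw [integral_const_mul, e2]; ring
  rw [e1, e3, ← Real.norm_eq_abs]
  refine norm_integral_le_of_norm_le (hI2.const_mul _) ?_
  refine (ae_restrict_iff' measurableSet_Ioi).2 (Filter.Eventually.of_forall fun x hx => ?_)
  have hx : 0 < x := hx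
  have e4 : g (-x) + g x = K (-(x / τ)) * (f x - f (-x)) := by
    have h := hKsym (x / τ)
    have h2 : -(-x / τ) = x / τ := by ring
    simp only [hg, h2, if_pos (by linarith : -x ≤ 0), if_neg (not_le.2 hx)]
    have : K (x / τ) = 1 - K (-(x / τ)) := by linarith
    rw [this]; ring
  have e5 : τ⁻¹ * x = x / τ := by ring
  have e6 : 2 * M * τ * (x / τ * K (-(x / τ))) = K (-(x / τ)) * (2 * M * x) := by
    field_simp
  rw [e4, e5, e6, Real.norm_eq_abs, abs_mul, abs_of_nonneg (hK0 _)]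
  exact mul_le_mul_of_nonneg_left (hlip x hx) (hK0 _)
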